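/- Interchange of infimum and integral (Rockafellar-type interchange). Let Z ⊆ ℝ^D and Y ⊆ ℝ^{D'} be nonempty compact sets, let P be a Borel probability measure on Z, and let g : Z × Y → ℝ be continuous. Then the infimum over Borel measurable maps T : Z → Y of ∫ g(z, T(z)) dP(z) equals ∫ (min_{b ∈ Y} g(z, b)) dP(z); moreover, this infimum is attained by some Borel measurable map T : Z → Y satisfying g(z, T(z)) = min_{b ∈ Y} g(z, b) for every z ∈ Z. -/

import Mathlib

open MeasureTheory

noncomputable section

/-- Euclidean space ℝ^D. -/
abbrev Euc (D : ℕ) := EuclideanSpace ℝ (Fin D)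

open Set Topology in
/-- A closed subset of `X × K`, with `K ⊆ ℝ` compact, having nonempty fibers over `X` admits a
Borel measurable selection, namely the least element of each fiber. -/
theorem exists_measurable_selection_of_isCompact_real {X : Type*} [TopologicalSpace X]
    [MeasurableSpace X] [OpensMeasurableSpace X] {K : Set ℝ} (hK : IsCompact K)
    {S : Set (X × K)} (hS : IsClosed S) (hne : ∀ x, ∃ t, (x, t) ∈ S) :
    ∃ u : X → K, Measurable u ∧ ∀ x, (x, u x) ∈ S := by
  have : CompactSpace K := isCompact_iff_compactSpace.mp hK
  have hleast : ∀ x, ∃ t, IsLeast {t : K | (x, t) ∈ S} t := fun x ↦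
    (hS.preimage (Continuous.prodMk_right x)).isCompact.exists_isLeast (hne x)
  choose u hu using hleast
  refine ⟨u, ?_, fun x ↦ (hu x).1⟩
  suffices h : Measurable fun x ↦ (u x : ℝ) from h.subtype_mk (h := fun x ↦ (u x).2)
  refine measurable_of_Iic fun t ↦ IsClosed.measurableSet ?_
  have himage : (fun x ↦ (u x : ℝ)) ⁻¹' Iic t =
      Prod.fst '' (S ∩ {p : X × K | (p.2 : ℝ) ≤ t}) := by
    ext x
    constructor
    · intro hx
      exact ⟨(x, u x), ⟨(hu x).1, hx⟩, rfl⟩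
    · rintro ⟨⟨x', s⟩, ⟨hs, hst⟩, rfl⟩
      exact le_trans (Subtype.coe_le_coe.mpr ((hu x').2 hs)) hst
  rw [himage]
  exact isClosedMap_fst_of_compactSpace _
    (hS.inter (isClosed_le (by fun_prop) continuous_const))

/-- A closed subset of `X × Y`, with `Y` compact metric, having nonempty fibers over `X` admits
a Borel measurable selection. -/
theorem exists_measurable_selection_of_isClosed {X Y : Type*} [TopologicalSpace X]
    [MeasurableSpace X] [OpensMeasurableSpace X] [MetricSpace Y] [CompactSpace Y] [Nonempty Y]
    [MeasurableSpace Y] [BorelSpace Y]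
    {S : Set (X × Y)} (hS : IsClosed S) (hne : ∀ x, ∃ y, (x, y) ∈ S) :
    ∃ T : X → Y, Measurable T ∧ ∀ x, (x, T x) ∈ S := by
  obtain ⟨f, hf, hsurj⟩ := exists_nat_bool_continuous_surjective_of_compact Y
  let φ : cantorSet → Y := f ∘ cantorSetHomeomorphNatToBool
  have hφ : Continuous φ := hf.comp cantorSetHomeomorphNatToBool.continuous
  have hφs : Function.Surjective φ := hsurj.comp cantorSetHomeomorphNatToBool.surjective
  obtain ⟨u, hu, huS⟩ := exists_measurable_selection_of_isCompact_real isCompact_cantorSet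
    (S := Prod.map id φ ⁻¹' S) (hS.preimage (continuous_id.prodMap hφ)) fun x ↦ by
      obtain ⟨y, hy⟩ := hne x
      obtain ⟨t, rfl⟩ := hφs y
      exact ⟨t, hy⟩
  exact ⟨φ ∘ u, hφ.measurable.comp hu, huS⟩

/-- A continuous function on a product `Z × Y` of compact sets has a Borel measurable choice of
minimizers in the second variable. -/
theorem exists_measurable_argmin {E F : Type*} [TopologicalSpace E] [MeasurableSpace E]
    [BorelSpace E] [MetricSpace F] [MeasurableSpace F] [BorelSpace F] {Z : Set E} {Y : Set F}
    (hZ : MeasurableSet Z) (hYne : Y.Nonempty) (hY : IsCompact Y) {g : E → F → ℝ}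
    (hg : ContinuousOn (fun p : E × F => g p.1 p.2) (Z ×ˢ Y)) :
    ∃ T : E → F, Measurable T ∧ (∀ z ∈ Z, T z ∈ Y) ∧
      ∀ z ∈ Z, g z (T z) = sInf (g z '' Y) := by
  classical
  have : CompactSpace Y := isCompact_iff_compactSpace.mp hY
  have : Nonempty Y := hYne.to_subtype
  let G : Z → Y → ℝ := fun z y ↦ g z y
  have hG : Continuous fun p : Z × Y ↦ G p.1 p.2 :=
    hg.comp_continuous (f := fun p : Z × Y ↦ ((p.1 : E), (p.2 : F))) (by fun_prop)
      fun p ↦ ⟨p.1.2, p.2.2⟩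
  have himage : ∀ z : Z, G z '' Set.univ = g z '' Y := fun z ↦ by
    ext t
    simp [G]
  have hmin : Continuous fun z : Z ↦ sInf (G z '' Set.univ) :=
    isCompact_univ.continuous_sInf hG
  obtain ⟨T, hT, hTS⟩ := exists_measurable_selection_of_isClosed
    (S := {p : Z × Y | G p.1 p.2 = sInf (G p.1 '' Set.univ)})
    (isClosed_eq hG (hmin.comp continuous_fst)) fun z ↦ by
      obtain ⟨y, -, hy⟩ := isCompact_univ.exists_sInf_image_eq Set.univ_nonempty
        (hG.comp (Continuous.prodMk_right z)).continuousOn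
      exact ⟨y, hy.symm⟩
  obtain ⟨y₀, -⟩ := hYne
  refine ⟨fun z ↦ if h : z ∈ Z then (T ⟨z, h⟩ : F) else y₀,
    Measurable.dite (s := Z) hT.subtype_val measurable_const hZ, fun z hz ↦ ?_, fun z hz ↦ ?_⟩
  · simp [hz]
  · simpa [hz, himage] using! hTS ⟨z, hz⟩

/-- A continuous function on a product of compact sets, composed with a measurable map, is
integrable for any finite measure. -/
theorem integrableOn_continuousOn_comp_measurable {E F : Type*} [TopologicalSpace E]
    [SecondCountableTopology E] [MeasurableSpace E] [BorelSpace E] [TopologicalSpace F]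
    [SecondCountableTopology F] [MeasurableSpace F] [BorelSpace F]
    {Z : Set E} {Y : Set F} (hZ : IsCompact Z) (hZm : MeasurableSet Z) (hY : IsCompact Y)
    {P : Measure E} [IsFiniteMeasure P] {g : E → F → ℝ}
    (hg : ContinuousOn (fun p : E × F => g p.1 p.2) (Z ×ˢ Y))
    {T : E → F} (hT : Measurable T) (hTY : ∀ z ∈ Z, T z ∈ Y) :
    IntegrableOn (fun z ↦ g z (T z)) Z P := by
  obtain ⟨C, hC⟩ := (hZ.prod hY).exists_bound_of_continuousOn hg
  refine IntegrableOn.of_bound (measure_lt_top P Z) ?_ C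
    (ae_restrict_of_forall_mem hZm fun z hz ↦ hC (z, T z) ⟨hz, hTY z hz⟩)
  have hG : Measurable fun z : Z ↦ g z (T z) :=
    (hg.domRestrict.measurable).comp
      (g := (Z ×ˢ Y).domRestrict fun p : E × F => g p.1 p.2)
      (f := fun z : Z ↦ ⟨((z : E), T z), z.2, hTY z z.2⟩)
      ((measurable_subtype_coe.prodMk (hT.comp measurable_subtype_coe)).subtype_mk)
  rw [← map_comap_subtype_coe hZm P,
    (MeasurableEmbedding.subtype_coe hZm).aestronglyMeasurable_map_iff]
  exact hG.aestronglyMeasurable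

/-- Rockafellar-type interchange of infimum and integral: for `Z ⊆ ℝ^D`, `Y ⊆ ℝ^{D'}`
nonempty compact, `P` a Borel probability measure on `Z`, and `g : Z × Y → ℝ` continuous,
the infimum over Borel measurable maps `T : Z → Y` of `∫ g(z, T z) dP` equals
`∫ (min_{b ∈ Y} g(z, b)) dP`; moreover the infimum is attained by some Borel measurable
`T` with `g(z, T z) = min_{b ∈ Y} g(z, b)` for every `z ∈ Z`. -/
theorem interchange_inf_integral
    (D D' : ℕ) (hD : 0 < D) (hD' : 0 < D')
    (Z : Set (Euc D)) (Y : Set (Euc D'))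
    (hZne : Z.Nonempty) (hZcpt : IsCompact Z)
    (hYne : Y.Nonempty) (hYcpt : IsCompact Y)
    (P : Measure (Euc D)) (hP : IsProbabilityMeasure P) (hPsupp : P Zᶜ = 0)
    (g : Euc D → Euc D' → ℝ)
    (hg : ContinuousOn (fun p : Euc D × Euc D' => g p.1 p.2) (Z ×ˢ Y)) :
    sInf { x : ℝ | ∃ T : Euc D → Euc D', Measurable T ∧ (∀ z ∈ Z, T z ∈ Y) ∧
        x = ∫ z in Z, g z (T z) ∂P }
      = ∫ z in Z, sInf (g z '' Y) ∂P
    ∧ ∃ T : Euc D → Euc D', Measurable T ∧ (∀ z ∈ Z, T z ∈ Y) ∧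
        (∀ z ∈ Z, g z (T z) = sInf (g z '' Y)) ∧
        ∫ z in Z, g z (T z) ∂P
          = sInf { x : ℝ | ∃ T' : Euc D → Euc D', Measurable T' ∧
              (∀ z ∈ Z, T' z ∈ Y) ∧ x = ∫ z in Z, g z (T' z) ∂P } := by
  have hZm : MeasurableSet Z := hZcpt.measurableSet
  obtain ⟨T, hT, hTY, hTmin⟩ := exists_measurable_argmin hZm hYne hYcpt hg
  have hint : ∫ z in Z, g z (T z) ∂P = ∫ z in Z, sInf (g z '' Y) ∂P :=
    setIntegral_congr_fun hZm hTmin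
  have hleast : IsLeast { x : ℝ | ∃ T : Euc D → Euc D', Measurable T ∧ (∀ z ∈ Z, T z ∈ Y) ∧
      x = ∫ z in Z, g z (T z) ∂P } (∫ z in Z, g z (T z) ∂P) := by
    refine ⟨⟨T, hT, hTY, rfl⟩, ?_⟩
    rintro _ ⟨T', hT', hTY', rfl⟩
    refine setIntegral_mono_on
      (integrableOn_continuousOn_comp_measurable hZcpt hZm hYcpt hg hT hTY)
      (integrableOn_continuousOn_comp_measurable hZcpt hZm hYcpt hg hT' hTY') hZm fun z hz ↦ ?_
    rw [hTmin z hz]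
    have hgz : ContinuousOn (g z) Y :=
      hg.comp (f := fun y ↦ (z, y)) (by fun_prop) fun y hy ↦ ⟨hz, hy⟩
    exact csInf_le (hYcpt.bddBelow_image hgz) ⟨T' z, hTY' z hz, rfl⟩
  exact ⟨hleast.csInf_eq.trans hint, T, hT, hTY, hTmin, hleast.csInf_eq.symm⟩
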